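/- arXiv:1007.1220 — 2 statements merged into one kernel-verified Lean document; each statement's English description precedes it below -/
import Mathlib

section
/- Let Ω be the first Brocard point of triangle ABC, and let Γ be any circle through Ω. If lines AΩ, BΩ, CΩ meet Γ again at Z, X, Y respectively (all distinct from Ω), then triangle XYZ is indirectly similar to triangle ABC. -/
open EuclideanGeometry Real Complex

open scoped ComplexConjugate

/-- A line through a point `P` of a circle with centre `O`, in the direction of `A - P`, meets the
circle again at the reflection of `P` in the diameter perpendicular to the line. -/
lemma second_intersection_mul_conj {A P Z O : ℂ} {r : ℝ} (hP : P ∈ Metric.sphere O r)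
    (hZ : Z ∈ Metric.sphere O r) (hl : Z ∈ affineSpan ℝ ({A, P} : Set ℂ)) (hne : Z ≠ P) :
    (Z - O) * conj (A - P) = conj (O - P) * (A - P) := by
  obtain ⟨t, rfl⟩ := mem_affineSpan_pair_iff_exists_lineMap_eq.1 hl
  rw [mem_sphere_iff_norm] at hP hZ
  have hs : (1 - (t : ℂ)) ≠ 0 := by
    intro h
    apply hne
    have : t = 1 := by exact_mod_cast (sub_eq_zero.1 h).symm
    simp [this]
  have e : ∀ w : ℂ, ‖w‖ = r → w * conj w = (r : ℂ) ^ 2 := by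
    rintro w rfl
    exact Complex.mul_conj' w
  have h1 := e _ hP
  have h2 := e _ hZ
  simp only [AffineMap.lineMap_apply_module, Complex.real_smul, map_sub, map_add, map_mul,
    Complex.conj_ofReal, Complex.ofReal_sub, Complex.ofReal_one, map_one] at h1 h2 ⊢
  apply mul_left_cancel₀ hs
  linear_combination h2 - h1

/-- Three affinely independent points of the plane have nonzero signed area. -/
lemma im_conj_mul_ne_zero_of_affineIndependent {A B C : ℂ} (h : AffineIndependent ℝ ![A, B, C]) :
    (conj (B - A) * (C - A)).im ≠ 0 := by
  intro h0
  rw [affineIndependent_iff_not_collinear_set, collinear_iff_of_mem (p₀ := A) (by simp)] at h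
  apply h
  by_cases hBA : B - A = 0
  · refine ⟨C - A, ?_⟩
    rintro p (rfl | rfl | rfl)
    · exact ⟨0, by simp⟩
    · exact ⟨0, by simpa using sub_eq_zero.1 hBA⟩
    · exact ⟨1, by simp⟩
  · refine ⟨B - A, ?_⟩
    rintro p (rfl | rfl | rfl)
    · exact ⟨0, by simp⟩
    · exact ⟨1, by simp⟩
    · refine ⟨(conj (B - A) * (p - A)).re / ‖B - A‖ ^ 2, ?_⟩
      have hre : ((conj (B - A) * (p - A)).re : ℂ) = conj (B - A) * (p - A) :=
        Complex.ext (by simp) (by rw [h0, Complex.ofReal_im])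
      have hn : ((‖B - A‖ : ℂ)) ^ 2 = (B - A) * conj (B - A) := (Complex.mul_conj' _).symm
      have hc : conj (B - A) ≠ 0 := (map_ne_zero _).2 hBA
      rw [vadd_eq_add, Complex.real_smul, Complex.ofReal_div, hre, Complex.ofReal_pow, hn]
      field_simp
      ring

/-- A point in the interior of a triangle is a convex combination of the vertices with positive
weights. -/
lemma exists_pos_weights_of_mem_interior_triangle {A B C P : ℂ}
    (h : AffineIndependent ℝ ![A, B, C])
    (hP : P ∈ interior (convexHull ℝ ({A, B, C} : Set ℂ))) :
    ∃ p q s : ℝ, 0 < p ∧ 0 < q ∧ 0 < s ∧ p * (A - P) + q * (B - P) + s * (C - P) = 0 := by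
  have htop : affineSpan ℝ (Set.range ![A, B, C]) = ⊤ :=
    h.affineSpan_eq_top_iff_card_eq_finrank_add_one.2 (by simp)
  let T : AffineBasis (Fin 3) ℝ ℂ := ⟨![A, B, C], h, htop⟩
  have hr : Set.range T = {A, B, C} := by
    change Set.range ![A, B, C] = _
    rw [Matrix.range_cons, Matrix.range_cons_cons_empty, Set.singleton_union]
  rw [← hr, T.interior_convexHull] at hP
  refine ⟨T.coord 0 P, T.coord 1 P, T.coord 2 P, hP 0, hP 1, hP 2, ?_⟩
  have h1 := T.sum_coord_apply_eq_one P
  have h2 := T.linear_combination_coord_eq_self P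
  rw [Fin.sum_univ_three] at h1 h2
  have h1' : (T.coord 0 P : ℂ) + T.coord 1 P + T.coord 2 P = 1 := by exact_mod_cast h1
  change T.coord 0 P • A + T.coord 1 P • B + T.coord 2 P • C = P at h2
  simp only [Complex.real_smul] at h2
  linear_combination h2 - P * h1'

/-- Complex numbers on the same side of the real axis with equal absolute arguments have equal
arguments. -/
lemma arg_eq_of_abs_arg_eq {z w : ℂ} (h : |arg z| = |arg w|) (hs : 0 < z.im * w.im) :
    arg z = arg w := by
  rcases abs_eq_abs.1 h with h | h
  · exact h
  · exfalso
    rcases mul_pos_iff.1 hs with ⟨hz, hw⟩ | ⟨hz, hw⟩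
    · have hz' := Complex.arg_nonneg_iff.2 hz.le
      have hw' := Complex.arg_nonneg_iff.2 hw.le
      have : arg w = 0 := by linarith
      exact hw.ne' (Complex.arg_eq_zero_iff.1 this).2
    · have hz' := Complex.arg_neg_iff.2 hz
      have hw' := Complex.arg_neg_iff.2 hw
      linarith

lemma im_sub_div_neg (a b : ℂ) : ((b - a) / (-a)).im = -(conj a * b).im / normSq a := by
  rw [Complex.div_im]
  simp only [Complex.sub_re, Complex.sub_im, Complex.neg_re, Complex.neg_im, Complex.mul_im,
    Complex.conj_re, Complex.conj_im, Complex.normSq_neg]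
  ring

/-- Equal unoriented angles at the vertices `a` and `b` of two triangles `0 a b` and `0 b c` of
the same orientation are equal as arguments of quotients of sides. -/
lemma arg_sub_div_neg_eq {a b c : ℂ}
    (h : InnerProductGeometry.angle (-a) (b - a) = InnerProductGeometry.angle (-b) (c - b))
    (hs : 0 < (conj a * b).im * (conj b * c).im) :
    arg ((b - a) / (-a)) = arg ((c - b) / (-b)) := by
  have ha : a ≠ 0 := by rintro rfl; simp at hs
  have hb : b ≠ 0 := by rintro rfl; simp at hs
  have hba : b - a ≠ 0 := by
    intro h0
    rw [sub_eq_zero.1 h0, mul_comm (conj a) a, Complex.mul_conj, Complex.ofReal_im] at hs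
    simp at hs
  have hcb : c - b ≠ 0 := by
    intro h0
    rw [sub_eq_zero.1 h0, mul_comm (conj b) b, Complex.mul_conj, Complex.ofReal_im] at hs
    simp at hs
  rw [InnerProductGeometry.angle_comm, InnerProductGeometry.angle_comm (-b),
    Complex.angle_eq_abs_arg hba (neg_ne_zero.2 ha),
    Complex.angle_eq_abs_arg hcb (neg_ne_zero.2 hb)] at h
  refine arg_eq_of_abs_arg_eq h ?_
  rw [im_sub_div_neg, im_sub_div_neg, div_mul_div_comm, neg_mul_neg]
  exact div_pos hs (mul_pos (Complex.normSq_pos.2 ha) (Complex.normSq_pos.2 hb))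

lemma sub_eq_real_mul_mul_exp_arg {a b : ℂ} (ha : a ≠ 0) :
    b - a = ((-‖(b - a) / (-a)‖ : ℝ) : ℂ) * a * Complex.exp (arg ((b - a) / (-a)) * I) := by
  have h := Complex.norm_mul_exp_arg_mul_I ((b - a) / (-a))
  rw [eq_div_iff (neg_ne_zero.2 ha)] at h
  rw [← h]
  push_cast
  rw [h]
  linear_combination -h

/-- If the sides of the triangle `a b c` are obtained from its vertices by rotation through a common
angle and real scaling, then the reflections of a point in the lines spanned by `b`, `c`, `a`
form a triangle indirectly similar to it. -/
lemma exists_indirect_similarity_of_spiral {a b c v o : ℂ} {x y z : ℝ}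
    (hab : b - a = x * a * v) (hbc : c - b = y * b * v) (hca : a - c = z * c * v)
    (h₁ : (conj a * b).im ≠ 0) (h₂ : (conj b * c).im ≠ 0) (ho : o ≠ 0) :
    ∃ α : ℂ, α ≠ 0 ∧
      α * conj (a - b) = o * (b / conj b - c / conj c) ∧
      α * conj (b - c) = o * (c / conj c - a / conj a) := by
  have ha : a ≠ 0 := by rintro rfl; simp at h₁
  have hb : b ≠ 0 := by rintro rfl; simp at h₁
  have hc : c ≠ 0 := by rintro rfl; simp at h₂
  have ha' : conj a ≠ 0 := by simpa using ha
  have hb' : conj b ≠ 0 := by simpa using hb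
  have hc' : conj c ≠ 0 := by simpa using hc
  have key : ∀ p q : ℂ, (conj p * q).im ≠ 0 → p * conj q - q * conj p ≠ 0 := by
    intro p q hpq h
    apply hpq
    apply Complex.conj_eq_iff_im.1
    rw [map_mul, Complex.conj_conj]
    linear_combination h
  have k₁ := key _ _ h₁
  have k₂ := key _ _ h₂
  have hab' : conj b - conj a = x * conj a * conj v := by simpa using congrArg conj hab
  have hbc' : conj c - conj b = y * conj b * conj v := by simpa using congrArg conj hbc
  have hca' : conj a - conj c = z * conj c * conj v := by simpa using congrArg conj hca
  have e₁ : a * conj b - b * conj a = x * (a * conj a) * (conj v - v) := by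
    linear_combination a * hab' - conj a * hab
  have e₂ : b * conj c - c * conj b = y * (b * conj b) * (conj v - v) := by
    linear_combination b * hbc' - conj b * hbc
  have e₃ : c * conj a - a * conj c = z * (c * conj c) * (conj v - v) := by
    linear_combination c * hca' - conj c * hca
  rw [e₁] at k₁
  rw [e₂] at k₂
  have hx : (x : ℂ) ≠ 0 := by intro h; simp [h] at k₁
  have hy : (y : ℂ) ≠ 0 := by intro h; simp [h] at k₂
  have hd : conj v - v ≠ 0 := right_ne_zero_of_mul k₁
  have hv : v ≠ 0 := by rintro rfl; simp at hd
  have hv' : conj v ≠ 0 := by simpa using hv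
  have s₁ : x * a + y * b + z * c = 0 := by
    apply mul_right_cancel₀ hv
    linear_combination -hab - hbc - hca
  have s₁' : x * conj a + y * conj b + z * conj c = 0 := by simpa using congrArg conj s₁
  have s₂' : y * (b * conj b) * conj a + z * (c * conj c) * conj b
      + x * (a * conj a) * conj c = 0 := by
    apply mul_right_cancel₀ hd
    linear_combination -conj a * e₂ - conj b * e₃ - conj c * e₁
  have s₂ : y * (b * conj b) * a + z * (c * conj c) * b + x * (a * conj a) * c = 0 := by
    have := congrArg conj s₂'
    simp only [map_add, map_mul, Complex.conj_conj, Complex.conj_ofReal, map_zero] at this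
    linear_combination this
  have hlen : (y : ℂ) ^ 2 * (b * conj b) = x * z * (c * conj c) := by
    apply mul_right_cancel₀ k₂
    rw [← e₂]
    linear_combination (y * (b * conj b)) * (s₁ * conj c - s₁' * c) - x * (s₂ * conj c - s₂' * c)
  refine ⟨-(o * y * b * (conj v - v)) / (conj c * x * conj a * conj v), ?_, ?_, ?_⟩
  · simp [*]
  · have h : conj (a - b) = -(x * conj a * conj v) := by rw [map_sub]; linear_combination -hab'
    rw [h, div_sub_div _ _ hb' hc', mul_comm (conj b) c, e₂]
    field_simp
  · have h : conj (b - c) = -(y * conj b * conj v) := by rw [map_sub]; linear_combination -hbc'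
    rw [h, div_sub_div _ _ hc' ha', mul_comm (conj c) a, e₃]
    field_simp
    linear_combination hlen

/-- Omega circle theorem: if lines AΩ, BΩ, CΩ through the first Brocard point Ω
meet a circle Γ through Ω again at Z, X, Y, then XYZ is indirectly similar to ABC
(an orientation-reversing similarity maps A↦X, B↦Y, C↦Z). -/
theorem omega_circle_indirect_similarity (A B C Ω X Y Z O : ℂ) (r : ℝ)
    (hnd : AffineIndependent ℝ ![A, B, C])
    (hΩint : Ω ∈ interior (convexHull ℝ ({A, B, C} : Set ℂ)))
    (h1 : ∠ Ω A B = ∠ Ω B C) (h2 : ∠ Ω B C = ∠ Ω C A)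
    (hr : 0 < r) (hΩΓ : Ω ∈ Metric.sphere O r)
    (hZΓ : Z ∈ Metric.sphere O r) (hXΓ : X ∈ Metric.sphere O r)
    (hYΓ : Y ∈ Metric.sphere O r)
    (hZ : Z ∈ affineSpan ℝ ({A, Ω} : Set ℂ)) (hZne : Z ≠ Ω)
    (hX : X ∈ affineSpan ℝ ({B, Ω} : Set ℂ)) (hXne : X ≠ Ω)
    (hY : Y ∈ affineSpan ℝ ({C, Ω} : Set ℂ)) (hYne : Y ≠ Ω) :
    ∃ α β : ℂ, α ≠ 0 ∧
      α * (starRingEnd ℂ) A + β = X ∧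
      α * (starRingEnd ℂ) B + β = Y ∧
      α * (starRingEnd ℂ) C + β = Z := by
  have area := im_conj_mul_ne_zero_of_affineIndependent hnd
  obtain ⟨p, q, s, hp, hq, hs, hpqs⟩ := exists_pos_weights_of_mem_interior_triangle hnd hΩint
  have eZ := second_intersection_mul_conj hΩΓ hZΓ hZ hZne
  have eX := second_intersection_mul_conj hΩΓ hXΓ hX hXne
  have eY := second_intersection_mul_conj hΩΓ hYΓ hY hYne
  simp only [EuclideanGeometry.angle, vsub_eq_sub] at h1 h2
  have ho : conj (O - Ω) ≠ 0 := by
    rw [Ne, map_eq_zero, sub_eq_zero]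
    rintro rfl
    simp at hΩΓ
    exact hr.ne hΩΓ
  obtain ⟨a, ha⟩ : ∃ a, a = A - Ω := ⟨_, rfl⟩
  obtain ⟨b, hb⟩ : ∃ b, b = B - Ω := ⟨_, rfl⟩
  obtain ⟨c, hc⟩ : ∃ c, c = C - Ω := ⟨_, rfl⟩
  rw [← ha, ← hb, ← hc] at hpqs
  rw [← ha] at eZ
  rw [← hb] at eX
  rw [← hc] at eY
  rw [show Ω - A = -a by rw [ha]; ring, show Ω - B = -b by rw [hb]; ring,
    show B - A = b - a by rw [ha, hb]; ring, show C - B = c - b by rw [hb, hc]; ring] at h1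
  rw [show Ω - B = -b by rw [hb]; ring, show Ω - C = -c by rw [hc]; ring,
    show C - B = c - b by rw [hb, hc]; ring, show A - C = a - c by rw [ha, hc]; ring] at h2
  rw [show B - A = b - a by rw [ha, hb]; ring, show C - A = c - a by rw [ha, hc]; ring] at area
  have hre := congrArg Complex.re hpqs
  have him := congrArg Complex.im hpqs
  simp at hre him
  have hsum : (conj (b - a) * (c - a)).im
      = (conj a * b).im + (conj b * c).im + (conj c * a).im := by
    simp; ring
  have hqs : q * (conj a * b).im = s * (conj c * a).im := by
    simp; linear_combination a.re * him - a.im * hre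
  have hps : p * (conj a * b).im = s * (conj b * c).im := by
    simp; linear_combination b.im * hre - b.re * him
  have eca : (conj c * a).im = q / s * (conj a * b).im := by
    field_simp; linear_combination -hqs
  have ebc : (conj b * c).im = p / s * (conj a * b).im := by
    field_simp; linear_combination -hps
  have n₁ : (conj a * b).im ≠ 0 := by
    intro h0
    rw [hsum, eca, ebc, h0] at area
    simp at area
  have n₂ : (conj b * c).im ≠ 0 := by
    rw [ebc]; positivity
  have o₁ : 0 < (conj a * b).im * (conj b * c).im := by
    rw [ebc]
    have : 0 < p / s * (conj a * b).im ^ 2 := by positivity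
    linarith
  have o₂ : 0 < (conj b * c).im * (conj c * a).im := by
    rw [ebc, eca]
    have : 0 < p / s * (q / s) * (conj a * b).im ^ 2 := by positivity
    linarith
  have a0 : a ≠ 0 := by rintro rfl; simp at n₁
  have b0 : b ≠ 0 := by rintro rfl; simp at n₁
  have c0 : c ≠ 0 := by rintro rfl; simp at n₂
  have g₁ := arg_sub_div_neg_eq h1 o₁
  have g₂ := arg_sub_div_neg_eq h2 o₂
  have r₁ := sub_eq_real_mul_mul_exp_arg (b := b) a0
  have r₂ := sub_eq_real_mul_mul_exp_arg (b := c) b0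
  have r₃ := sub_eq_real_mul_mul_exp_arg (b := a) c0
  rw [← g₂, ← g₁] at r₃
  rw [← g₁] at r₂
  obtain ⟨α, hα, q₁, q₂⟩ := exists_indirect_similarity_of_spiral r₁ r₂ r₃ n₁ n₂ ho
  have fX : X - O = conj (O - Ω) * (b / conj b) := by
    rw [← mul_div_assoc]; exact eq_div_of_mul_eq (by simpa using b0) eX
  have fY : Y - O = conj (O - Ω) * (c / conj c) := by
    rw [← mul_div_assoc]; exact eq_div_of_mul_eq (by simpa using c0) eY
  have fZ : Z - O = conj (O - Ω) * (a / conj a) := by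
    rw [← mul_div_assoc]; exact eq_div_of_mul_eq (by simpa using a0) eZ
  rw [show a - b = A - B by rw [ha, hb]; ring, map_sub] at q₁
  rw [show b - c = B - C by rw [hb, hc]; ring, map_sub] at q₂
  refine ⟨α, X - α * conj A, hα, by ring, ?_, ?_⟩
  · linear_combination fX - fY - q₁
  · linear_combination fX - fZ - q₁ - q₂
end

section
/- Let Ω′ be the second Brocard point of triangle ABC, and let Γ be any circle through Ω′. If lines AΩ′, BΩ′, CΩ′ meet Γ again at Y, Z, X respectively, then triangle XYZ is indirectly similar to triangle ABC. -/
open EuclideanGeometry Real Complex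

open ComplexConjugate in
/-- A point of a circle through `0`, on the line spanned by `a`, in terms of the centre `o`. -/
lemma second_intersection_eq {a o y : ℂ} {r t : ℝ} (hy : y = t * a) (hy0 : y ≠ 0)
    (ho : ‖o‖ = r) (hyo : ‖y - o‖ = r) : y = o + conj o * (a / conj a) := by
  have hoo : o * conj o = (r : ℂ) ^ 2 := by rw [Complex.mul_conj', ho]
  have hyy : (y - o) * (conj y - conj o) = (r : ℂ) ^ 2 := by
    rw [← map_sub, Complex.mul_conj', hyo]
  have ha : a ≠ 0 := by
    rintro rfl
    simp [hy] at hy0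
  have ht : (t : ℂ) ≠ 0 := by
    intro h
    simp [hy, h] at hy0
  have ha' : conj a ≠ 0 := by simpa using ha
  subst hy
  simp only [map_mul, Complex.conj_ofReal] at hyy
  field_simp
  have : (t : ℂ) * (t * a * conj a - (o * conj a + a * conj o)) = 0 := by
    linear_combination hyy - hoo
  rcases mul_eq_zero.mp this with h | h
  · exact absurd h ht
  · linear_combination h

/-- Nonzero complex numbers with imaginary parts of the same sign and equal absolute arguments
have equal arguments. -/
lemma arg_eq_of_abs_arg_eq_s5 {u v : ℂ} (h : |u.arg| = |v.arg|) (him : 0 < u.im * v.im) :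
    u.arg = v.arg := by
  rcases pos_and_pos_or_neg_and_neg_of_mul_pos him with ⟨hu, hv⟩ | ⟨hu, hv⟩
  · rwa [abs_of_nonneg (Complex.arg_nonneg_iff.mpr hu.le),
      abs_of_nonneg (Complex.arg_nonneg_iff.mpr hv.le)] at h
  · rw [abs_of_neg (Complex.arg_neg_iff.mpr hu), abs_of_neg (Complex.arg_neg_iff.mpr hv)] at h
    linarith

/-- An angle at `B` as the argument of a quotient. -/
lemma angle_eq_abs_arg_one_sub_div {P A B : ℂ} (hB : B ≠ P) (hAB : A ≠ B) :
    ∠ P B A = |(1 - (A - P) / (B - P)).arg| := by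
  have h : 1 - (A - P) / (B - P) = (A - B) / (P - B) := by
    have h1 := sub_ne_zero.mpr hB
    have h2 := sub_ne_zero.mpr hB.symm
    field_simp
    ring
  rw [h, EuclideanGeometry.angle, InnerProductGeometry.angle_comm, vsub_eq_sub, vsub_eq_sub,
    Complex.angle_eq_abs_arg (sub_ne_zero.mpr hAB) (sub_ne_zero.mpr hB.symm)]

/-- A point in the interior of a triangle has positive barycentric coordinates. -/
lemma exists_pos_barycentric {A B C P : ℂ} (hnd : AffineIndependent ℝ ![A, B, C])
    (hP : P ∈ interior (convexHull ℝ ({A, B, C} : Set ℂ))) :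
    ∃ x y z : ℝ, 0 < x ∧ 0 < y ∧ 0 < z ∧ x + y + z = 1 ∧ x * A + y * B + z * C = P := by
  let b : AffineBasis (Fin 3) ℝ ℂ := ⟨![A, B, C], hnd, by
    rw [hnd.affineSpan_eq_top_iff_card_eq_finrank_add_one]
    simp [Complex.finrank_real_complex]⟩
  have hr : Set.range b = {A, B, C} := by
    change Set.range ![A, B, C] = _
    rw [Matrix.range_cons, Matrix.range_cons, Matrix.range_cons, Matrix.range_empty,
      Set.union_empty, Set.singleton_union, Set.singleton_union]
  rw [← hr, b.interior_convexHull] at hP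
  refine ⟨b.coord 0 P, b.coord 1 P, b.coord 2 P, hP 0, hP 1, hP 2, ?_, ?_⟩
  · have := b.sum_coord_apply_eq_one P
    rwa [Fin.sum_univ_three] at this
  · have := b.linear_combination_coord_eq_self P
    rw [Fin.sum_univ_three] at this
    simp only [Complex.real_smul] at this
    exact this

/-- The vertices of a nondegenerate triangle have nonzero cross product. -/
lemma cross_ne_zero {A B C : ℂ} (hnd : AffineIndependent ℝ ![A, B, C]) :
    (B.re - A.re) * (C.im - A.im) - (B.im - A.im) * (C.re - A.re) ≠ 0 := by
  intro h
  have hAB : A ≠ B := fun h' => by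
    simpa using hnd.injective.ne (show (0 : Fin 3) ≠ 1 by decide) h'
  rw [affineIndependent_iff_not_collinear_set] at hnd
  apply hnd
  rw [collinear_iff_of_mem (p₀ := A) (by simp)]
  refine ⟨B - A, ?_⟩
  have hn : (B.re - A.re) ^ 2 + (B.im - A.im) ^ 2 ≠ 0 := by
    intro h0
    apply hAB
    apply Complex.ext <;> nlinarith [sq_nonneg (B.re - A.re), sq_nonneg (B.im - A.im)]
  intro p hp
  rcases hp with rfl | rfl | rfl
  · exact ⟨0, by simp⟩
  · exact ⟨1, by simp⟩
  · refine ⟨((B.re - A.re) * (p.re - A.re) + (B.im - A.im) * (p.im - A.im)) /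
      ((B.re - A.re) ^ 2 + (B.im - A.im) ^ 2), ?_⟩
    apply Complex.ext
    · simp only [vadd_eq_add, Complex.real_smul,
        Complex.add_re, Complex.re_ofReal_mul, Complex.sub_re]
      field_simp
      linear_combination -(B.im - A.im) * h
    · simp only [vadd_eq_add, Complex.real_smul,
        Complex.add_im, Complex.im_ofReal_mul, Complex.sub_im]
      field_simp
      linear_combination (B.re - A.re) * h

/-- The sign of the imaginary part of `1 - a / b` is that of the cross product of `a` and `b`. -/
lemma im_one_sub_div (a b : ℂ) :
    (1 - a / b).im = (a.re * b.im - a.im * b.re) / Complex.normSq b := by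
  rw [Complex.sub_im, Complex.div_im, Complex.one_im]
  ring

open ComplexConjugate in
/-- The Brocard relations for the vertex positions `a`, `b`, `c` relative to the Brocard point,
where `w` is the unit number of the Brocard angle. -/
lemma brocard_identity {a b c w : ℂ} {p q s : ℝ} (ha : a ≠ 0) (hb : b ≠ 0) (hc : c ≠ 0)
    (hw : w * conj w = 1) (hwim : w ≠ conj w)
    (hp : 1 - a / b = p * w) (hq : 1 - b / c = q * w) (hs : 1 - c / a = s * w) :
    (c / conj c - a / conj a) * conj (c - a) = (b / conj b - c / conj c) * conj (a - b) := by
  have key : (1 - p * w) * (1 - q * w) * (1 - s * w) = 1 := by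
    rw [← hp, ← hq, ← hs]
    field_simp
    ring
  have hw0 : w ≠ 0 := by
    rintro rfl
    simp at hw
  have cancel : ∀ v : ℂ, v ≠ 0 → (1 - p * v) * (1 - q * v) * (1 - s * v) = 1 →
      (p * q + q * s + s * p) * v = (p + q + s) + p * q * s * v ^ 2 := by
    intro v hv h
    apply mul_left_cancel₀ hv
    linear_combination h
  have e := cancel w hw0 key
  have e' := cancel (conj w) (by simpa using hw0) (by simpa using congrArg conj key)
  have e2 : (p * q + q * s + s * p : ℂ) = p * q * s * (w + conj w) := by
    apply mul_left_cancel₀ (sub_ne_zero.mpr hwim)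
    linear_combination e - e'
  have e1 : (p + q + s : ℂ) = p * q * s := by
    linear_combination -e + w * e2 + p * q * s * hw
  have hca : c = a * (1 - s * w) := by
    rw [← hs]
    field_simp
    ring
  have hbc : b = c * (1 - q * w) := by
    rw [← hq]
    field_simp
    ring
  have hab : a = b * (1 - p * w) := by
    rw [← hp]
    field_simp
    ring
  have hca' : conj c = conj a * (1 - s * conj w) := by simpa using congrArg conj hca
  have hbc' : conj b = conj c * (1 - q * conj w) := by simpa using congrArg conj hbc
  have hab' : conj a = conj b * (1 - p * conj w) := by simpa using congrArg conj hab
  have ha' : conj a ≠ 0 := by simpa using ha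
  have hb' : conj b ≠ 0 := by simpa using hb
  have hc' : conj c ≠ 0 := by simpa using hc
  have hsca : conj (c - a) = -(conj a * s * conj w) := by
    rw [map_sub]
    linear_combination hca'
  have hsab : conj (a - b) = -(conj b * p * conj w) := by
    rw [map_sub]
    linear_combination hab'
  have main : (c * conj a - a * conj c) * s = (b * conj c - c * conj b) * p := by
    have h1 : c * conj a - a * conj c = a * conj a * (s * (conj w - w)) := by
      linear_combination conj a * hca - a * hca'
    have h2 : b * conj c - c * conj b = c * conj c * (q * (conj w - w)) := by
      linear_combination conj c * hbc - c * hbc'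
    have h3 : (s : ℂ) ^ 2 = p * q * ((1 - s * w) * (1 - s * conj w)) := by
      linear_combination s * e1 - e2 - p * q * s ^ 2 * hw
    rw [h1, h2, hca, map_mul, map_sub, map_mul, map_one, Complex.conj_ofReal]
    linear_combination a * conj a * (conj w - w) * h3
  rw [hsca, hsab]
  field_simp
  linear_combination -conj w * main

/-- Omega prime circle theorem: if lines AΩ′, BΩ′, CΩ′ through the second Brocard
point Ω′ meet a circle Γ through Ω′ again at Y, Z, X, then XYZ is indirectly
similar to ABC (an orientation-reversing similarity maps A↦X, B↦Y, C↦Z). -/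
theorem omega_prime_circle_indirect_similarity (A B C Ω' X Y Z O : ℂ) (r : ℝ)
    (hnd : AffineIndependent ℝ ![A, B, C])
    (hΩint : Ω' ∈ interior (convexHull ℝ ({A, B, C} : Set ℂ)))
    (h1 : ∠ Ω' B A = ∠ Ω' C B) (h2 : ∠ Ω' C B = ∠ Ω' A C)
    (hr : 0 < r) (hΩΓ : Ω' ∈ Metric.sphere O r)
    (hYΓ : Y ∈ Metric.sphere O r) (hZΓ : Z ∈ Metric.sphere O r)
    (hXΓ : X ∈ Metric.sphere O r)
    (hY : Y ∈ affineSpan ℝ ({A, Ω'} : Set ℂ)) (hYne : Y ≠ Ω')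
    (hZ : Z ∈ affineSpan ℝ ({B, Ω'} : Set ℂ)) (hZne : Z ≠ Ω')
    (hX : X ∈ affineSpan ℝ ({C, Ω'} : Set ℂ)) (hXne : X ≠ Ω') :
    ∃ α β : ℂ, α ≠ 0 ∧
      α * (starRingEnd ℂ) A + β = X ∧
      α * (starRingEnd ℂ) B + β = Y ∧
      α * (starRingEnd ℂ) C + β = Z := by
  obtain ⟨x, y, z, hx, hy, hz, hsum, hbar⟩ := exists_pos_barycentric hnd hΩint
  have hD := cross_ne_zero hnd
  set D := (B.re - A.re) * (C.im - A.im) - (B.im - A.im) * (C.re - A.re) with hDdef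
  have hre : Ω'.re = x * A.re + y * B.re + z * C.re := by rw [← hbar]; simp
  have him : Ω'.im = x * A.im + y * B.im + z * C.im := by rw [← hbar]; simp
  obtain rfl : x = 1 - y - z := by linarith
  have cAB : (A - Ω').re * (B - Ω').im - (A - Ω').im * (B - Ω').re = z * D := by
    simp only [Complex.sub_re, Complex.sub_im, hre, him, hDdef]
    ring
  have cBC : (B - Ω').re * (C - Ω').im - (B - Ω').im * (C - Ω').re = (1 - y - z) * D := by
    simp only [Complex.sub_re, Complex.sub_im, hre, him, hDdef]
    ring
  have cCA : (C - Ω').re * (A - Ω').im - (C - Ω').im * (A - Ω').re = y * D := by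
    simp only [Complex.sub_re, Complex.sub_im, hre, him, hDdef]
    ring
  have ne_zero_left : ∀ {u v : ℂ} {k : ℝ}, 0 < k → u.re * v.im - u.im * v.re = k * D → u ≠ 0 := by
    rintro u v k hk h rfl
    simp [hk.ne', hD] at h
  have ha : A - Ω' ≠ 0 := ne_zero_left hz cAB
  have hb : B - Ω' ≠ 0 := ne_zero_left hx cBC
  have hc : C - Ω' ≠ 0 := ne_zero_left hy cCA
  have hinj := hnd.injective
  have hAB : A ≠ B := hinj.ne (show (0 : Fin 3) ≠ 1 by decide)
  have hBC : B ≠ C := hinj.ne (show (1 : Fin 3) ≠ 2 by decide)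
  have hCA : C ≠ A := hinj.ne (show (2 : Fin 3) ≠ 0 by decide)
  rw [angle_eq_abs_arg_one_sub_div (sub_ne_zero.mp hb) hAB,
    angle_eq_abs_arg_one_sub_div (sub_ne_zero.mp hc) hBC] at h1
  rw [angle_eq_abs_arg_one_sub_div (sub_ne_zero.mp hc) hBC,
    angle_eq_abs_arg_one_sub_div (sub_ne_zero.mp ha) hCA] at h2
  have iAB := im_one_sub_div (A - Ω') (B - Ω')
  have iBC := im_one_sub_div (B - Ω') (C - Ω')
  have iCA := im_one_sub_div (C - Ω') (A - Ω')
  rw [cAB] at iAB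
  rw [cBC] at iBC
  rw [cCA] at iCA
  have na := Complex.normSq_pos.mpr ha
  have nb := Complex.normSq_pos.mpr hb
  have nc := Complex.normSq_pos.mpr hc
  have hDD : 0 < D * D := mul_self_pos.mpr hD
  have arg1 := arg_eq_of_abs_arg_eq_s5 h1 (by
    rw [iAB, iBC, div_mul_div_comm, mul_mul_mul_comm]
    positivity)
  have arg2 := arg_eq_of_abs_arg_eq_s5 h2 (by
    rw [iBC, iCA, div_mul_div_comm, mul_mul_mul_comm]
    positivity)
  have him0 : (1 - (A - Ω') / (B - Ω')).im ≠ 0 := by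
    rw [iAB]
    exact div_ne_zero (mul_ne_zero hz.ne' hD) nb.ne'
  have pq := Complex.norm_mul_exp_arg_mul_I (1 - (A - Ω') / (B - Ω'))
  have qq := Complex.norm_mul_exp_arg_mul_I (1 - (B - Ω') / (C - Ω'))
  have sq := Complex.norm_mul_exp_arg_mul_I (1 - (C - Ω') / (A - Ω'))
  rw [← arg2, ← arg1] at sq
  rw [← arg1] at qq
  set w := Complex.exp ((1 - (A - Ω') / (B - Ω')).arg * Complex.I) with hw
  have hww : w * (starRingEnd ℂ) w = 1 := by
    rw [Complex.mul_conj', hw, Complex.norm_exp_ofReal_mul_I]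
    simp
  have hwim : w ≠ (starRingEnd ℂ) w := by
    intro h
    have hw0 : w.im = 0 := Complex.conj_eq_iff_im.mp h.symm
    apply him0
    rw [← pq, Complex.im_ofReal_mul, hw0, mul_zero]
  have key := brocard_identity ha hb hc hww hwim pq.symm qq.symm sq.symm
  have hO : ‖O - Ω'‖ = r := by
    rw [← dist_eq_norm, dist_comm]
    exact hΩΓ
  have second : ∀ {P Q : ℂ}, Q ∈ Metric.sphere O r → Q ∈ affineSpan ℝ ({P, Ω'} : Set ℂ) →
      Q ≠ Ω' → Q = O + (starRingEnd ℂ) (O - Ω') * ((P - Ω') / (starRingEnd ℂ) (P - Ω')) := by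
    intro P Q hQ hQl hQne
    rw [Set.pair_comm, mem_affineSpan_pair_iff_exists_lineMap_eq] at hQl
    obtain ⟨t, ht⟩ := hQl
    have := second_intersection_eq (a := P - Ω') (o := O - Ω') (y := Q - Ω') (r := r) (t := t)
      (by rw [← ht]; simp [AffineMap.lineMap_apply]) (sub_ne_zero.mpr hQne) hO
      (by rw [sub_sub_sub_cancel_right, ← dist_eq_norm]; exact hQ)
    linear_combination this
  have eX := second hXΓ hX hXne
  have eY := second hYΓ hY hYne
  have eZ := second hZΓ hZ hZne
  have hO0 : (starRingEnd ℂ) (O - Ω') ≠ 0 := by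
    rw [Ne, map_eq_zero, ← norm_eq_zero, hO]
    exact hr.ne'
  have hconj : (starRingEnd ℂ) (A - B) ≠ 0 := by
    rw [Ne, map_eq_zero]
    exact sub_ne_zero.mpr hAB
  have ha' : (starRingEnd ℂ) (A - Ω') ≠ 0 := by simpa only [Ne, map_eq_zero] using ha
  have hc' : (starRingEnd ℂ) (C - Ω') ≠ 0 := by simpa only [Ne, map_eq_zero] using hc
  have hdiff : (C - Ω') / (starRingEnd ℂ) (C - Ω') - (A - Ω') / (starRingEnd ℂ) (A - Ω') ≠ 0 := by
    rw [Ne, sub_eq_zero, div_eq_div_iff hc' ha']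
    intro h
    have h' := congrArg Complex.im h
    simp only [Complex.mul_im, Complex.conj_re, Complex.conj_im] at h'
    apply mul_ne_zero hy.ne' hD
    linarith
  set d := (C - Ω') / (starRingEnd ℂ) (C - Ω') - (A - Ω') / (starRingEnd ℂ) (A - Ω') with hd
  set α := (starRingEnd ℂ) (O - Ω') * d / (starRingEnd ℂ) (A - B) with hα
  have hα' : α * (starRingEnd ℂ) (A - B) = (starRingEnd ℂ) (O - Ω') * d :=
    div_mul_cancel₀ _ hconj
  refine ⟨α, X - α * (starRingEnd ℂ) A, div_ne_zero (mul_ne_zero hO0 hdiff) hconj,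
    by ring, ?_, ?_⟩
  · rw [map_sub] at hα'
    linear_combination eX - eY - hα' + (starRingEnd ℂ) (O - Ω') * hd
  · rw [sub_sub_sub_cancel_right, sub_sub_sub_cancel_right] at key
    have hαC : α * (starRingEnd ℂ) (C - A) = (starRingEnd ℂ) (O - Ω') *
        ((B - Ω') / (starRingEnd ℂ) (B - Ω') - (C - Ω') / (starRingEnd ℂ) (C - Ω')) := by
      apply mul_right_cancel₀ hconj
      linear_combination (starRingEnd ℂ) (C - A) * hα' + (starRingEnd ℂ) (O - Ω') * key
    rw [map_sub] at hαC
    linear_combination hαC + eX - eZ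
end
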